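/- Let σ_{v,t} = { x_i ↦ e_i : 1 ≤ i ≤ t }. Then there is a constant c such that for every t ≥ 1, the formula Ψ_t has a tree refutation in IR-calc^{σ_{v,t}} of size at most c·t^c (polynomial in t). -/

import Mathlib

/-! ## Propositional / QBF side -/

inductive Lit where
  | pos (x : ℕ)
  | neg (x : ℕ)
deriving DecidableEq

def Lit.var : Lit → ℕ
  | pos x => x
  | neg x => x

def Lit.isPos : Lit → Bool
  | pos _ => true
  | neg _ => false

def Lit.negate : Lit → Lit
  | pos x => neg x
  | neg x => pos x

def Lit.eval (v : ℕ → Bool) : Lit → Bool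
  | pos x => v x
  | neg x => !(v x)

abbrev Clause := Finset Lit

def Clause.Taut (C : Clause) : Prop := ∃ x, Lit.pos x ∈ C ∧ Lit.neg x ∈ C

/-- A prenex CNF: a list of quantifier blocks (`true` = existential,
`false` = universal), each with an ordered list of variables, and a matrix
which is a finite set of clauses. -/
structure PCNF where
  blocks : List (Bool × List ℕ)
  matrix : Finset Clause

def PCNF.allVars (Φ : PCNF) : List ℕ := Φ.blocks.flatMap (·.2)

/-- Well-formedness: quantifier blocks alternate and the blocks are
pairwise disjoint sets of variables (no repetitions). -/
def PCNF.WF (Φ : PCNF) : Prop :=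
  List.Chain' (fun a b => a.1 ≠ b.1) Φ.blocks ∧ Φ.allVars.Nodup ∧
    ∀ b ∈ Φ.blocks, b.2 ≠ []

/-- Closedness: every variable of the matrix is quantified in the prefix. -/
def PCNF.Closed (Φ : PCNF) : Prop :=
  ∀ C ∈ Φ.matrix, ∀ l ∈ C, l.var ∈ Φ.allVars

def PCNF.existB (Φ : PCNF) (x : ℕ) : Bool :=
  Φ.blocks.any fun b => b.1 && b.2.contains x

def PCNF.univB (Φ : PCNF) (x : ℕ) : Bool :=
  Φ.blocks.any fun b => !b.1 && b.2.contains x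

/-- The level of a variable: the index of its quantifier block. -/
def PCNF.lv (Φ : PCNF) (x : ℕ) : ℕ :=
  Φ.blocks.findIdx fun b => b.2.contains x

def evalClause (v : ℕ → Bool) (C : Clause) : Prop := ∃ l ∈ C, l.eval v = true

/-- Standard QBF semantics of a prenex CNF, evaluated block by block. -/
def truthAux (M : Finset Clause) : List (Bool × List ℕ) → (ℕ → Bool) → Prop
  | [], v => ∀ C ∈ M, evalClause v C
  | (q, xs) :: rest, v =>
      if q then ∃ w : ℕ → Bool, (∀ y, y ∉ xs → w y = v y) ∧ truthAux M rest w
      else ∀ w : ℕ → Bool, (∀ y, y ∉ xs → w y = v y) → truthAux M rest w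

def PCNF.IsTrue (Φ : PCNF) : Prop := truthAux Φ.matrix Φ.blocks fun _ => false

/-! ## Q-resolution and QU-resolution -/

/-- One derivation step of Q-res (`univPivot = false`) resp. QU-res
(`univPivot = true`) from the clauses derived so far. -/
inductive QStep (Φ : PCNF) (univPivot : Bool) (prev : List Clause) : Clause → Prop
  | ax (C : Clause) (hC : C ∈ Φ.matrix) (hnt : ¬ C.Taut) : QStep Φ univPivot prev C
  | res (x : ℕ) (A B : Clause) (hA : A ∈ prev) (hB : B ∈ prev)
      (hxa : Lit.pos x ∈ A) (hxb : Lit.neg x ∈ B)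
      (hpiv : Φ.existB x = true ∨ (univPivot = true ∧ Φ.univB x = true))
      (hblock : ∀ l ∈ A.erase (Lit.pos x), l.negate ∉ B.erase (Lit.neg x)) :
      QStep Φ univPivot prev ((A.erase (Lit.pos x)) ∪ (B.erase (Lit.neg x)))
  | fac (A : Clause) (hA : A ∈ prev) : QStep Φ univPivot prev A
  | univRed (A : Clause) (m : Lit) (hA : A ∈ prev) (hm : m ∈ A)
      (hu : Φ.univB m.var = true)
      (hlv : ∀ l ∈ A.erase m, Φ.existB l.var = true → Φ.lv l.var < Φ.lv m.var) :
      QStep Φ univPivot prev (A.erase m)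

def QValid (Φ : PCNF) (univPivot : Bool) (π : List Clause) : Prop :=
  ∀ i < π.length, QStep Φ univPivot (π.take i) π[i]!

def QRefutation (Φ : PCNF) (univPivot : Bool) (π : List Clause) : Prop :=
  QValid Φ univPivot π ∧ π ≠ [] ∧ π.getLast! = (∅ : Clause)

/-- Size of a (QBF) resolution derivation: total number of literal
occurrences in its clauses. -/
def qSize (π : List Clause) : ℕ := (π.map Finset.card).sum

/-! ## First-order terms, atoms, literals, clauses -/

inductive FTerm where
  | var (x : ℕ)
  | app (f : ℕ) (args : List FTerm)

noncomputable instance : DecidableEq FTerm := Classical.decEq _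

def FTerm.subst (σ : ℕ → FTerm) : FTerm → FTerm
  | .var x => σ x
  | .app f args => .app f (args.attach.map fun t => t.1.subst σ)
decreasing_by
  have := List.sizeOf_lt_of_mem t.2
  simp only [FTerm.app.sizeOf_spec]; omega

def FTerm.symSize : FTerm → ℕ
  | .var _ => 1
  | .app _ args => 1 + (args.attach.map fun t => t.1.symSize).sum
decreasing_by
  have := List.sizeOf_lt_of_mem t.2
  simp only [FTerm.app.sizeOf_spec]; omega

def FTerm.vars : FTerm → Finset ℕ
  | .var x => {x}
  | .app _ args => (args.attach.map fun t => t.1.vars).foldr (· ∪ ·) ∅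
decreasing_by
  have := List.sizeOf_lt_of_mem t.2
  simp only [FTerm.app.sizeOf_spec]; omega

/-- An atom `p(t₁,…,t_k)`: predicate symbol together with argument list. -/
structure FAtom where
  p : ℕ
  args : List FTerm

noncomputable instance : DecidableEq FAtom := Classical.decEq _

def FAtom.subst (σ : ℕ → FTerm) (a : FAtom) : FAtom := ⟨a.p, a.args.map (FTerm.subst σ)⟩
def FAtom.symSize (a : FAtom) : ℕ := 1 + (a.args.map FTerm.symSize).sum
def FAtom.vars (a : FAtom) : Finset ℕ := (a.args.map FTerm.vars).foldr (· ∪ ·) ∅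

inductive FLit where
  | pos (a : FAtom)
  | neg (a : FAtom)

noncomputable instance : DecidableEq FLit := Classical.decEq _

def FLit.atom : FLit → FAtom
  | pos a => a
  | neg a => a

def FLit.isPos : FLit → Bool
  | pos _ => true
  | neg _ => false

def FLit.subst (σ : ℕ → FTerm) : FLit → FLit
  | pos a => pos (a.subst σ)
  | neg a => neg (a.subst σ)

def FLit.symSize (l : FLit) : ℕ :=
  match l with
  | .pos a => a.symSize
  | .neg a => 1 + a.symSize

abbrev FClause := Finset FLit

noncomputable def FClause.subst (σ : ℕ → FTerm) (C : FClause) : FClause :=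
  C.image (FLit.subst σ)

noncomputable def FClause.symSize (C : FClause) : ℕ := ∑ l ∈ C, l.symSize

noncomputable def FClause.fvars (C : FClause) : Finset ℕ := C.sup fun l => l.atom.vars

/-! ## First-order resolution R1 -/

def compSub (σ μ : ℕ → FTerm) : ℕ → FTerm := fun x => (σ x).subst μ

def Unifies (σ : ℕ → FTerm) (a b : FAtom) : Prop := a.subst σ = b.subst σ

def IsMGU (σ : ℕ → FTerm) (a b : FAtom) : Prop :=
  Unifies σ a b ∧ ∀ τ, Unifies τ a b → ∃ μ, ∀ x, compSub σ μ x = τ x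

/-- `D` is a factor of `C`: `D = Cσ` for `σ` an mgu of two distinct
same-sign literals of `C`. -/
def IsFactor (C D : FClause) : Prop :=
  ∃ K L σ, K ∈ C ∧ L ∈ C ∧ K ≠ L ∧ K.isPos = L.isPos ∧
    IsMGU σ K.atom L.atom ∧ D = C.subst σ

def renameSub (ρ : ℕ → ℕ) : ℕ → FTerm := fun x => .var (ρ x)

/-- `E` is a resolvent of `C` and `D`. -/
def IsResolvent (C D E : FClause) : Prop :=
  ∃ ρ : ℕ → ℕ, Function.Injective ρ ∧
    ∃ K L σ, Disjoint C.fvars (FClause.subst (renameSub ρ) D).fvars ∧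
      K ∈ C ∧ L ∈ FClause.subst (renameSub ρ) D ∧ K.isPos = !L.isPos ∧
      IsMGU σ K.atom L.atom ∧
      E = ((C.subst σ).erase (K.subst σ)) ∪
          (((FClause.subst (renameSub ρ) D).subst σ).erase (L.subst σ))

def R1Valid (S : Set FClause) (π : List FClause) : Prop :=
  ∀ i < π.length,
    π[i]! ∈ S ∨ (∃ j < i, IsFactor π[j]! π[i]!) ∨
      (∃ j < i, ∃ k < i, IsResolvent π[j]! π[k]! π[i]!)

def R1Refutation (S : Set FClause) (π : List FClause) : Prop :=
  R1Valid S π ∧ π ≠ [] ∧ π.getLast! = (∅ : FClause)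

noncomputable def r1Size (π : List FClause) : ℕ := (π.map FClause.symSize).sum

/-- Tree-form R1 refutations: every clause occurrence is used at most once
as a premise, which is inherent in a tree-structured derivation. -/
inductive R1Tree (S : Set FClause) : FClause → Type
  | input (C : FClause) (h : C ∈ S) : R1Tree S C
  | factor {C : FClause} (t : R1Tree S C) (D : FClause) (h : IsFactor C D) : R1Tree S D
  | resolve {C D : FClause} (t₁ : R1Tree S C) (t₂ : R1Tree S D) (E : FClause)
      (h : IsResolvent C D E) : R1Tree S E

noncomputable def R1Tree.size {S : Set FClause} : {C : FClause} → R1Tree S C → ℕ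
  | C, .input _ _ => C.symSize
  | D, .factor t _ _ => t.size + D.symSize
  | E, .resolve t₁ t₂ _ _ => t₁.size + t₂.size + E.symSize

def R1Tree.clauseCount {S : Set FClause} : {C : FClause} → R1Tree S C → ℕ
  | _, .input _ _ => 1
  | _, .factor t _ _ => t.clauseCount + 1
  | _, .resolve t₁ t₂ _ _ => t₁.clauseCount + t₂.clauseCount + 1

/-! ## The Skolem and EPR translations -/

/-- The universal variables strictly preceding `a` in the prefix,
in prefix order. -/
def PCNF.univBefore (Φ : PCNF) (a : ℕ) : List ℕ :=
  ((Φ.blocks.flatMap fun b => b.2.map fun x => (b.1, x)).takeWhile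
      fun p => p.2 ≠ a).filterMap
    fun p => if p.1 = false then some p.2 else none

/-- `p` is the predicate symbol `0`; `f₀`, `f₁` are the constants `0`, `1`;
the Skolem function symbol for existential variable `a` is `a + 2`. -/
def skAtom (Φ : PCNF) (x : ℕ) : FAtom :=
  if Φ.existB x then ⟨0, [FTerm.app (x + 2) ((Φ.univBefore x).map FTerm.var)]⟩
  else ⟨0, [FTerm.var x]⟩

def skLit (Φ : PCNF) : Lit → FLit
  | .pos x => .pos (skAtom Φ x)
  | .neg x => .neg (skAtom Φ x)

noncomputable def skClause (Φ : PCNF) (C : Clause) : FClause := C.image (skLit Φ)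

def pf1Cl : FClause := {FLit.pos ⟨0, [FTerm.app 1 []]⟩}
def npf0Cl : FClause := {FLit.neg ⟨0, [FTerm.app 0 []]⟩}

/-- The clause set `Sk(Φ) ∪ {p(f₁), ¬p(f₀)}`. -/
noncomputable def skSet (Φ : PCNF) : Set FClause :=
  ↑(Φ.matrix.image (skClause Φ)) ∪ {pf1Cl, npf0Cl}

/-- EPR atom: `p(f_a(u₁,…,u_k))` with `k ≥ 1` becomes `p_a(u₁,…,u_k)`,
where the fresh predicate symbol `p_a` is `a + 1`. -/
def eprAtom (Φ : PCNF) (x : ℕ) : FAtom :=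
  if Φ.existB x then
    if Φ.univBefore x = [] then ⟨0, [FTerm.app (x + 2) []]⟩
    else ⟨x + 1, (Φ.univBefore x).map FTerm.var⟩
  else ⟨0, [FTerm.var x]⟩

def eprLit (Φ : PCNF) : Lit → FLit
  | .pos x => .pos (eprAtom Φ x)
  | .neg x => .neg (eprAtom Φ x)

noncomputable def eprClause (Φ : PCNF) (C : Clause) : FClause := C.image (eprLit Φ)

/-- The clause set `EPR(Φ) ∪ {p(f₁), ¬p(f₀)}`. -/
noncomputable def eprSet (Φ : PCNF) : Set FClause :=
  ↑(Φ.matrix.image (eprClause Φ)) ∪ {pf1Cl, npf0Cl}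

/-! ## IR-calc and its extensions -/

/-- An annotation: a (functional) finite set of assignments
`universal variable ↦ 0/1` (`false` = 0, `true` = 1). -/
abbrev Ann := Finset (ℕ × Bool)

def Ann.Functional (τ : Ann) : Prop := ∀ x b b', (x, b) ∈ τ → (x, b') ∈ τ → b = b'

/-- Restriction `[σ]` of an annotation to the universal variables of level
below the level of the literal `l`. -/
def annRestr (Φ : PCNF) (σ : Ann) (l : Lit) : Ann :=
  σ.filter fun p => Φ.lv p.1 < Φ.lv l.var

/-- Completion of `μ` by `τ`. -/
def annCompl (μ τ : Ann) : Ann :=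
  μ ∪ τ.filter fun p => p.1 ∉ μ.image Prod.fst

structure ALit where
  lit : Lit
  ann : Ann
deriving DecidableEq

abbrev AClause := Finset ALit

def ALit.symSize (al : ALit) : ℕ := 1 + 2 * al.ann.card
def AClause.symSize (A : AClause) : ℕ := ∑ al ∈ A, al.symSize
def aSize (π : List AClause) : ℕ := (π.map AClause.symSize).sum

/-- The annotation extracted from the universal literals of a clause:
`u ↦ 0` for positive and `u ↦ 1` for negative universal literals. -/
def axAnn (Φ : PCNF) (C : Clause) : Ann :=
  (C.filter fun l => Φ.univB l.var).image fun l =>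
    match l with
    | .pos u => (u, false)
    | .neg u => (u, true)

/-- The axiom clause of IR-calc obtained from a matrix clause. -/
def axClause (Φ : PCNF) (C : Clause) : AClause :=
  (C.filter fun l => Φ.existB l.var).image fun l => ⟨l, annRestr Φ (axAnn Φ C) l⟩

/-- Application of a variable substitution `σ_v` (universal ↦ existential)
to a literal. -/
def applySigv (σv : ℕ → Option ℕ) : Lit → Lit
  | .pos x => match σv x with | some e => .pos e | none => .pos x
  | .neg x => match σv x with | some e => .neg e | none => .neg x

def Clause.applySigv (σv : ℕ → Option ℕ) (C : Clause) : Clause :=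
  C.image (_root_.applySigv σv)

/-- Admissibility of `σ_v`: it maps universal variables to existential
variables of strictly smaller level. -/
def Admissible (Φ : PCNF) (σv : ℕ → Option ℕ) : Prop :=
  ∀ x e, σv x = some e → Φ.univB x = true ∧ Φ.existB e = true ∧ Φ.lv e < Φ.lv x

/-- One step of IR-calc(P, M, Δ, σ_v).  Plain IR-calc is the instance with
`Δ = ∅` and `σv = fun _ => none`; IR-calc^{σ_v} the instance with `Δ = ∅`. -/
inductive IRStep (Φ : PCNF) (Δ : Finset Clause) (σv : ℕ → Option ℕ)
    (prev : List AClause) : AClause → Prop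
  | ax (C : Clause) (hC : C ∈ Φ.matrix) (hnt : ¬ C.Taut)
      (hnt' : ¬ (C.applySigv σv).Taut) :
      IRStep Φ Δ σv prev (axClause Φ (C.applySigv σv))
  | axExt (C : Clause) (hC : C ∈ Δ) (hnt : ¬ C.Taut) :
      IRStep Φ Δ σv prev (C.image fun l => ⟨l, ∅⟩)
  | res (x : ℕ) (τ : Ann) (A B : AClause) (hA : A ∈ prev) (hB : B ∈ prev)
      (hxa : (⟨Lit.pos x, τ⟩ : ALit) ∈ A) (hxb : (⟨Lit.neg x, τ⟩ : ALit) ∈ B) :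
      IRStep Φ Δ σv prev ((A.erase ⟨Lit.pos x, τ⟩) ∪ (B.erase ⟨Lit.neg x, τ⟩))
  | fac (A : AClause) (hA : A ∈ prev) : IRStep Φ Δ σv prev A
  | inst (A : AClause) (τ : Ann) (hA : A ∈ prev) (hfun : τ.Functional)
      (hdom : ∀ p ∈ τ, Φ.univB p.1 = true) :
      IRStep Φ Δ σv prev
        (A.image fun al => ⟨al.lit, annRestr Φ (annCompl al.ann τ) al.lit⟩)

def IRValid (Φ : PCNF) (Δ : Finset Clause) (σv : ℕ → Option ℕ)
    (π : List AClause) : Prop :=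
  ∀ i < π.length, IRStep Φ Δ σv (π.take i) π[i]!

def IRRefutation (Φ : PCNF) (Δ : Finset Clause) (σv : ℕ → Option ℕ)
    (π : List AClause) : Prop :=
  IRValid Φ Δ σv π ∧ π ≠ [] ∧ π.getLast! = (∅ : AClause)

def noSub : ℕ → Option ℕ := fun _ => none

/-- Tree-form IR-calc(P, M, Δ, σ_v) derivations. -/
inductive IRTree (Φ : PCNF) (Δ : Finset Clause) (σv : ℕ → Option ℕ) : AClause → Type
  | ax (C : Clause) (hC : C ∈ Φ.matrix) (hnt : ¬ C.Taut)
      (hnt' : ¬ (C.applySigv σv).Taut) : IRTree Φ Δ σv (axClause Φ (C.applySigv σv))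
  | axExt (C : Clause) (hC : C ∈ Δ) (hnt : ¬ C.Taut) :
      IRTree Φ Δ σv (C.image fun l => ⟨l, ∅⟩)
  | res {A B : AClause} (t₁ : IRTree Φ Δ σv A) (t₂ : IRTree Φ Δ σv B)
      (x : ℕ) (τ : Ann)
      (hxa : (⟨Lit.pos x, τ⟩ : ALit) ∈ A) (hxb : (⟨Lit.neg x, τ⟩ : ALit) ∈ B) :
      IRTree Φ Δ σv ((A.erase ⟨Lit.pos x, τ⟩) ∪ (B.erase ⟨Lit.neg x, τ⟩))
  | inst {A : AClause} (t : IRTree Φ Δ σv A) (τ : Ann) (hfun : τ.Functional)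
      (hdom : ∀ p ∈ τ, Φ.univB p.1 = true) :
      IRTree Φ Δ σv (A.image fun al => ⟨al.lit, annRestr Φ (annCompl al.ann τ) al.lit⟩)

def IRTree.size {Φ : PCNF} {Δ : Finset Clause} {σv : ℕ → Option ℕ} :
    {A : AClause} → IRTree Φ Δ σv A → ℕ
  | _, .ax C _ _ _ => AClause.symSize (axClause Φ (C.applySigv σv))
  | _, .axExt C _ _ => AClause.symSize (C.image fun l => (⟨l, ∅⟩ : ALit))
  | _, .res (A := A) (B := B) t₁ t₂ x τ _ _ =>
      t₁.size + t₂.size +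
        AClause.symSize ((A.erase ⟨Lit.pos x, τ⟩) ∪ (B.erase ⟨Lit.neg x, τ⟩))
  | _, .inst (A := A) t τ _ _ =>
      t.size + AClause.symSize (A.image fun al =>
        (⟨al.lit, annRestr Φ (annCompl al.ann τ) al.lit⟩ : ALit))

/-! ## The formula families Φ_n and Ω_n (pigeonhole based) -/

def xv (i j : ℕ) : ℕ := Nat.pair 0 (Nat.pair i (Nat.pair j 0))
def yv (i j : ℕ) : ℕ := Nat.pair 1 (Nat.pair i (Nat.pair j 0))
def zv (i₁ i₂ j : ℕ) : ℕ := Nat.pair 2 (Nat.pair i₁ (Nat.pair i₂ j))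

def Xlist (n : ℕ) : List ℕ :=
  (List.range (n+1)).flatMap fun i => (List.range n).map fun j => xv (i+1) (j+1)
def Ylist (n : ℕ) : List ℕ :=
  (List.range (n+1)).flatMap fun i => (List.range n).map fun j => yv (i+1) (j+1)
def Zlist (n : ℕ) : List ℕ :=
  ((List.range (n+1)).map fun i => zv (i+1) 0 0) ++
  ((List.range n).flatMap fun j => (List.range (n+1)).flatMap fun i₁ =>
    (List.range (n+1)).filterMap fun i₂ =>
      if i₁ < i₂ then some (zv (i₁+1) (i₂+1) (j+1)) else none)

/-- The clauses of PHP_n(X_n). -/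
def PHPcls (n : ℕ) : Finset Clause :=
  ((List.range (n+1)).map fun i =>
      (((List.range n).map fun j => Lit.pos (xv (i+1) (j+1))).toFinset : Clause)).toFinset ∪
  ((List.range n).flatMap fun j => (List.range (n+1)).flatMap fun i₁ =>
    (List.range (n+1)).filterMap fun i₂ =>
      if i₁ < i₂ then
        some ({Lit.neg (xv (i₁+1) (j+1)), Lit.neg (xv (i₂+1) (j+1))} : Clause)
      else none).toFinset

/-- The clauses of TPHP′_n(Y_n, Z_n). -/
def TPHPcls (n : ℕ) : Finset Clause :=
  {(((Zlist n).map Lit.neg).toFinset : Clause)} ∪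
  ((List.range (n+1)).flatMap fun i => (List.range n).map fun j =>
      ({Lit.pos (zv (i+1) 0 0), Lit.neg (yv (i+1) (j+1))} : Clause)).toFinset ∪
  ((List.range n).flatMap fun j => (List.range (n+1)).flatMap fun i₁ =>
    (List.range (n+1)).flatMap fun i₂ =>
      if i₁ < i₂ then
        [({Lit.pos (zv (i₁+1) (i₂+1) (j+1)), Lit.pos (yv (i₁+1) (j+1))} : Clause),
         ({Lit.pos (zv (i₁+1) (i₂+1) (j+1)), Lit.pos (yv (i₂+1) (j+1))} : Clause)]
      else []).toFinset

def phiMatrix (n : ℕ) : Finset Clause := TPHPcls n ∪ PHPcls n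

/-- Φ_n = ∃X_n ∀Y_n ∃Z_n (TPHP′_n ∧ PHP_n). -/
def PhiF (n : ℕ) : PCNF :=
  ⟨[(true, Xlist n), (false, Ylist n), (true, Zlist n)], phiMatrix n⟩

/-- Ω_n = ∀Y_n ∃Z_n ∃X_n (TPHP′_n ∧ PHP_n) (Z_n and X_n form one block). -/
def OmegaF (n : ℕ) : PCNF :=
  ⟨[(false, Ylist n), (true, Zlist n ++ Xlist n)], phiMatrix n⟩

/-! ## The formula family Ψ_t of Kleine Büning, Karpinski and Flögel -/

def dv (j : ℕ) : ℕ := 5*j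
def ev (j : ℕ) : ℕ := 5*j+1
def xvv (j : ℕ) : ℕ := 5*j+2
def fv (j : ℕ) : ℕ := 5*j+3
def qv (j : ℕ) : ℕ := 5*j+4

/-- The prefix P_t; if `withQ` is set, the fresh extension variable `q_i`
is placed in the same existential block as `d_i` and `e_i`. -/
def psiPrefix (t : ℕ) (withQ : Bool) : List (Bool × List ℕ) :=
  ((true, [dv 0, dv 1, ev 1] ++ if withQ then [qv 1] else []) ::
    (List.range (t-1)).flatMap fun j =>
      [(false, [xvv (j+1)]),
       (true, [dv (j+2), ev (j+2)] ++ if withQ then [qv (j+2)] else [])]) ++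
  [(false, [xvv t]), (true, (List.range t).map fun i => fv (i+1))]

def fNegs (t : ℕ) : List Lit := (List.range t).map fun i => Lit.neg (fv (i+1))

def psiMatrix (t : ℕ) : Finset Clause :=
  ({({Lit.neg (dv 0)} : Clause),
    ({Lit.pos (dv 0), Lit.neg (dv 1), Lit.neg (ev 1)} : Clause),
    (((Lit.pos (dv t) :: Lit.neg (xvv t) :: fNegs t).toFinset : Clause)),
    (((Lit.pos (ev t) :: Lit.pos (xvv t) :: fNegs t).toFinset : Clause))} : Finset Clause) ∪
  ((List.range (t-1)).flatMap fun j =>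
     [({Lit.pos (dv (j+1)), Lit.neg (xvv (j+1)), Lit.neg (dv (j+2)), Lit.neg (ev (j+2))} : Clause),
      ({Lit.pos (ev (j+1)), Lit.pos (xvv (j+1)), Lit.neg (dv (j+2)), Lit.neg (ev (j+2))} : Clause)]).toFinset ∪
  ((List.range t).flatMap fun j =>
     [({Lit.neg (xvv (j+1)), Lit.pos (fv (j+1))} : Clause),
      ({Lit.pos (xvv (j+1)), Lit.pos (fv (j+1))} : Clause)]).toFinset

def PsiF (t : ℕ) : PCNF := ⟨psiPrefix t false, psiMatrix t⟩

/-- Ψ_t with the extension variables q_i added to the prefix. -/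
def PsiFq (t : ℕ) : PCNF := ⟨psiPrefix t true, psiMatrix t⟩

/-- The extension clauses Δ: clausal form of q_i ↔ (¬d_i ∧ e_i), 1 ≤ i ≤ t. -/
def DeltaT (t : ℕ) : Finset Clause :=
  ((List.range t).flatMap fun i =>
    [({Lit.pos (qv (i+1)), Lit.pos (dv (i+1)), Lit.neg (ev (i+1))} : Clause),
     ({Lit.neg (qv (i+1)), Lit.neg (dv (i+1))} : Clause),
     ({Lit.neg (qv (i+1)), Lit.pos (ev (i+1))} : Clause)]).toFinset

/-- σ_{v,t} = { x_i ↦ q_i : 1 ≤ i ≤ t }. -/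
def sigmaQv (t : ℕ) : ℕ → Option ℕ := fun v =>
  if v % 5 = 2 ∧ 1 ≤ v / 5 ∧ v / 5 ≤ t then some (5 * (v / 5) + 4) else none

/-- σ_{v,t} = { x_i ↦ e_i : 1 ≤ i ≤ t }. -/
def sigmaEv (t : ℕ) : ℕ → Option ℕ := fun v =>
  if v % 5 = 2 ∧ 1 ≤ v / 5 ∧ v / 5 ≤ t then some (5 * (v / 5) + 1) else none


/-- Lift a clause to an annotated clause with empty annotations. -/
def liftCl (C : Clause) : AClause := C.image fun l => (⟨l, ∅⟩ : ALit)

/-- The variables that are existential in `PsiF t`. -/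
def GoodVar (t v : ℕ) : Prop :=
  (v % 5 = 0 ∧ v / 5 ≤ t) ∨ ((v % 5 = 1 ∨ v % 5 = 3) ∧ 1 ≤ v / 5 ∧ v / 5 ≤ t)

lemma good_exist (t v : ℕ) (ht : 1 ≤ t) (h : GoodVar t v) : (PsiF t).existB v = true := by
  simp only [PCNF.existB, PsiF, psiPrefix, List.any_eq_true]
  obtain ⟨h0, h1⟩ | ⟨h0 | h0, h1, h2⟩ := h
  · by_cases h2 : v / 5 ≤ 1
    · refine ⟨(true, [dv 0, dv 1, ev 1]), by simp, ?_⟩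
      simp [dv, ev]; omega
    · refine ⟨(true, [dv (v / 5 - 2 + 2), ev (v / 5 - 2 + 2)]), ?_, ?_⟩
      · simp only [List.mem_append, List.mem_cons, List.mem_flatMap, List.mem_range]
        left; right
        exact ⟨v / 5 - 2, by omega, by simp⟩
      · simp [dv, ev]; omega
  · by_cases h2 : v / 5 ≤ 1
    · refine ⟨(true, [dv 0, dv 1, ev 1]), by simp, ?_⟩
      simp [dv, ev]; omega
    · refine ⟨(true, [dv (v / 5 - 2 + 2), ev (v / 5 - 2 + 2)]), ?_, ?_⟩
      · simp only [List.mem_append, List.mem_cons, List.mem_flatMap, List.mem_range]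
        left; right
        exact ⟨v / 5 - 2, by omega, by simp⟩
      · simp [dv, ev]; omega
  · refine ⟨(true, (List.range t).map fun i => fv (i+1)), by simp, ?_⟩
    simp only [List.contains_iff_mem, Bool.true_and, List.mem_map, List.mem_range]
    exact ⟨v / 5 - 1, by omega, by simp only [fv]; omega⟩

lemma good_univ (t v : ℕ) (h : GoodVar t v) : (PsiF t).univB v = false := by
  rw [Bool.eq_false_iff]
  intro hu
  simp only [PCNF.univB, PsiF, psiPrefix, List.any_eq_true] at hu
  obtain ⟨b, hb, hv⟩ := hu
  simp only [List.mem_append, List.mem_cons, List.mem_flatMap, List.mem_range] at hb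
  have : v % 5 = 2 := by
    obtain (rfl | ⟨j, hj, rfl | rfl | hb⟩) | rfl | rfl | hb := hb
    all_goals first
      | (simp at hb; done)
      | (simp [xvv] at hv <;> omega)
  unfold GoodVar at h
  omega

lemma axClause_good (t : ℕ) (ht : 1 ≤ t) (C : Clause) (h : ∀ l ∈ C, GoodVar t l.var) :
    axClause (PsiF t) C = liftCl C := by
  have h1 : axAnn (PsiF t) C = ∅ := by
    unfold axAnn
    rw [Finset.filter_eq_empty_iff.2, Finset.image_empty]
    intro l hl
    rw [good_univ t _ (h l hl)]; simp
  have h2 : (C.filter fun l => (PsiF t).existB l.var = true) = C :=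
    Finset.filter_true_of_mem fun l hl => good_exist t _ ht (h l hl)
  unfold axClause liftCl
  rw [h2, h1]
  simp [annRestr]

lemma lift_inj : Function.Injective fun l => (⟨l, ∅⟩ : ALit) := by
  intro a b h
  simpa using h

lemma lift_size (C : Clause) : AClause.symSize (liftCl C) = C.card := by
  unfold AClause.symSize liftCl
  rw [Finset.sum_image (fun a _ b _ h => lift_inj h)]
  simp [ALit.symSize]

/-- `C` has a tree derivation of size at most `n`. -/
def Der (t : ℕ) (C : Clause) (n : ℕ) : Prop :=
  ∃ d : IRTree (PsiF t) ∅ (sigmaEv t) (liftCl C), d.size ≤ n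

lemma der_ax {t : ℕ} (ht : 1 ≤ t) (C C' : Clause) (n : ℕ) (hC : C ∈ psiMatrix t)
    (hnt : ¬ C.Taut) (he : C.applySigv (sigmaEv t) = C') (hnt' : ¬ C'.Taut)
    (hg : ∀ l ∈ C', GoodVar t l.var) (hn : C'.card ≤ n) : Der t C' n := by
  subst he
  have hax := axClause_good t ht _ hg
  have key : ∃ d : IRTree (PsiF t) ∅ (sigmaEv t)
      (axClause (PsiF t) (C.applySigv (sigmaEv t))), d.size ≤ n := by
    refine ⟨IRTree.ax C hC hnt hnt', ?_⟩
    change AClause.symSize (axClause (PsiF t) (C.applySigv (sigmaEv t))) ≤ n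
    rw [hax, lift_size]; exact hn
  rw [hax] at key
  exact key

lemma der_res {t : ℕ} {A B : Clause} {n m : ℕ} (hA : Der t A n) (hB : Der t B m)
    (x : ℕ) (hxa : Lit.pos x ∈ A) (hxb : Lit.neg x ∈ B) (C : Clause) (k : ℕ)
    (hC : A.erase (Lit.pos x) ∪ B.erase (Lit.neg x) = C) (hk : C.card ≤ k) :
    Der t C (n + m + k) := by
  obtain ⟨dA, hdA⟩ := hA
  obtain ⟨dB, hdB⟩ := hB
  have e : (liftCl A).erase ⟨Lit.pos x, ∅⟩ ∪ (liftCl B).erase ⟨Lit.neg x, ∅⟩ = liftCl C := by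
    subst hC
    unfold liftCl
    rw [Finset.image_union, Finset.image_erase lift_inj, Finset.image_erase lift_inj]
  have key : ∃ d : IRTree (PsiF t) ∅ (sigmaEv t)
      ((liftCl A).erase ⟨Lit.pos x, ∅⟩ ∪ (liftCl B).erase ⟨Lit.neg x, ∅⟩),
      d.size ≤ n + m + k := by
    refine ⟨IRTree.res dA dB x ∅ (Finset.mem_image_of_mem _ hxa)
      (Finset.mem_image_of_mem _ hxb), ?_⟩
    change dA.size + dB.size + AClause.symSize ((liftCl A).erase ⟨Lit.pos x, ∅⟩ ∪
      (liftCl B).erase ⟨Lit.neg x, ∅⟩) ≤ n + m + k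
    rw [e, lift_size]; omega
  rw [e] at key
  exact key

lemma sig_x (t j : ℕ) (h1 : 1 ≤ j) (h2 : j ≤ t) : sigmaEv t (xvv j) = some (ev j) := by
  have : xvv j / 5 = j := by unfold xvv; omega
  unfold sigmaEv
  rw [if_pos (by rw [this]; unfold xvv; omega), this]; rfl
lemma sig_d (t j : ℕ) : sigmaEv t (dv j) = none := by
  unfold sigmaEv dv; rw [if_neg (by omega)]
lemma sig_e (t j : ℕ) : sigmaEv t (ev j) = none := by
  unfold sigmaEv ev; rw [if_neg (by omega)]
lemma sig_f (t j : ℕ) : sigmaEv t (fv j) = none := by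
  unfold sigmaEv fv; rw [if_neg (by omega)]

lemma mem_fNegs (k : ℕ) (l : Lit) :
    l ∈ fNegs k ↔ ∃ i, i < k ∧ Lit.neg (fv (i+1)) = l := by
  simp [fNegs]

lemma good_d {t j : ℕ} (h : j ≤ t) : GoodVar t (dv j) := by unfold GoodVar dv; omega
lemma good_e {t j : ℕ} (h1 : 1 ≤ j) (h : j ≤ t) : GoodVar t (ev j) := by
  unfold GoodVar ev; omega
lemma good_f {t j : ℕ} (h1 : 1 ≤ j) (h : j ≤ t) : GoodVar t (fv j) := by
  unfold GoodVar fv; omega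

lemma fNegs_card (k : ℕ) : (fNegs k).toFinset.card ≤ k :=
  (List.toFinset_card_le _).trans (by simp [fNegs])

lemma der_start {t : ℕ} (ht : 1 ≤ t) : Der t {Lit.neg (dv 1), Lit.neg (ev 1)} 6 := by
  have a : Der t {Lit.neg (dv 0)} 1 := by
    refine der_ax ht {Lit.neg (dv 0)} _ _ (by simp [psiMatrix]) (by simp [Clause.Taut])
      (by simp [Clause.applySigv, applySigv, sig_d]) (by simp [Clause.Taut]) ?_ (by simp)
    simp [Lit.var, good_d]
  have b : Der t {Lit.pos (dv 0), Lit.neg (dv 1), Lit.neg (ev 1)} 3 := by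
    refine der_ax ht {Lit.pos (dv 0), Lit.neg (dv 1), Lit.neg (ev 1)} _ _
      (by simp [psiMatrix]) (by simp [Clause.Taut, dv, ev])
      (by simp [Clause.applySigv, applySigv, sig_d, sig_e])
      (by simp [Clause.Taut, dv, ev]) ?_ Finset.card_le_three
    simp [Lit.var, good_d, good_e, ht]
  refine der_res b a (dv 0) (by simp) (by simp) _ 2 ?_ Finset.card_le_two
  ext l; cases l <;> simp [dv, ev] <;> omega

lemma der_step {t j n : ℕ} (hj : 1 ≤ j) (hjt : j + 1 ≤ t)
    (h : Der t {Lit.neg (dv j), Lit.neg (ev j)} n) :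
    Der t {Lit.neg (dv (j+1)), Lit.neg (ev (j+1))} (n + 12) := by
  obtain ⟨i, rfl⟩ : ∃ i, j = i + 1 := ⟨j - 1, by omega⟩
  have ht : 1 ≤ t := by omega
  have a : Der t {Lit.pos (dv (i+1)), Lit.neg (ev (i+1)), Lit.neg (dv (i+2)),
      Lit.neg (ev (i+2))} 4 := by
    refine der_ax ht {Lit.pos (dv (i+1)), Lit.neg (xvv (i+1)), Lit.neg (dv (i+2)),
      Lit.neg (ev (i+2))} _ _ ?_ ?_ ?_ ?_ ?_ Finset.card_le_four
    · simp only [psiMatrix, Finset.mem_union, List.mem_toFinset, List.mem_flatMap, List.mem_range]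
      left; right
      exact ⟨i, by omega, by simp⟩
    · rintro ⟨x, h1, h2⟩
      simp [dv, ev, xvv] at h1 h2; omega
    · simp [Clause.applySigv, applySigv, sig_d, sig_e, sig_x t (i+1) hj (by omega)]
    · rintro ⟨x, h1, h2⟩
      simp [dv, ev] at h1 h2; omega
    · simp only [Finset.mem_insert, Finset.mem_singleton]
      rintro l (rfl | rfl | rfl | rfl)
      exacts [good_d (by omega), good_e (by omega) (by omega), good_d (by omega),
        good_e (by omega) (by omega)]
  have b : Der t {Lit.pos (ev (i+1)), Lit.neg (dv (i+2)), Lit.neg (ev (i+2))} 3 := by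
    refine der_ax ht {Lit.pos (ev (i+1)), Lit.pos (xvv (i+1)), Lit.neg (dv (i+2)),
      Lit.neg (ev (i+2))} _ _ ?_ ?_ ?_ ?_ ?_ Finset.card_le_three
    · simp only [psiMatrix, Finset.mem_union, List.mem_toFinset, List.mem_flatMap, List.mem_range]
      left; right
      exact ⟨i, by omega, by simp⟩
    · rintro ⟨x, h1, h2⟩
      simp [dv, ev, xvv] at h1 h2; omega
    · simp [Clause.applySigv, applySigv, sig_d, sig_e, sig_x t (i+1) hj (by omega)]
    · rintro ⟨x, h1, h2⟩
      simp [dv, ev] at h1 h2; omega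
    · simp only [Finset.mem_insert, Finset.mem_singleton]
      rintro l (rfl | rfl | rfl)
      exacts [good_e (by omega) (by omega), good_d (by omega), good_e (by omega) (by omega)]
  have c : Der t {Lit.neg (ev (i+1)), Lit.neg (dv (i+2)), Lit.neg (ev (i+2))} (4 + n + 3) := by
    refine der_res a h (dv (i+1)) (by simp) (by simp) _ 3 ?_ Finset.card_le_three
    ext l; cases l <;> simp [dv, ev] <;> omega
  have d : Der t {Lit.neg (dv (i+1+1)), Lit.neg (ev (i+1+1))} (3 + (4 + n + 3) + 2) := by
    refine der_res b c (ev (i+1)) (by simp) (by simp) _ 2 ?_ Finset.card_le_two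
    ext l; cases l <;> simp [dv, ev] <;> omega
  convert d using 1; omega

lemma der_chain {t : ℕ} (ht : 1 ≤ t) (j : ℕ) (h : j + 1 ≤ t) :
    Der t {Lit.neg (dv (j+1)), Lit.neg (ev (j+1))} (6 + 12 * j) := by
  induction j with
  | zero => exact der_start ht
  | succ j ih => exact der_step (by omega) h (ih (by omega))

lemma der_unit {t j : ℕ} (hj : j + 1 ≤ t) : Der t {Lit.pos (fv (j+1))} 5 := by
  have ht : 1 ≤ t := by omega
  have a : Der t {Lit.neg (ev (j+1)), Lit.pos (fv (j+1))} 2 := by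
    refine der_ax ht {Lit.neg (xvv (j+1)), Lit.pos (fv (j+1))} _ _ ?_ ?_ ?_ ?_ ?_
      Finset.card_le_two
    · simp only [psiMatrix, Finset.mem_union, List.mem_toFinset, List.mem_flatMap, List.mem_range]
      right
      exact ⟨j, by omega, by simp⟩
    · rintro ⟨x, h1, h2⟩
      simp [fv, xvv] at h1 h2; omega
    · simp [Clause.applySigv, applySigv, sig_f, sig_x t (j+1) (by omega) hj]
    · rintro ⟨x, h1, h2⟩
      simp [fv, ev] at h1 h2; omega
    · simp only [Finset.mem_insert, Finset.mem_singleton]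
      rintro l (rfl | rfl)
      exacts [good_e (by omega) (by omega), good_f (by omega) (by omega)]
  have b : Der t {Lit.pos (ev (j+1)), Lit.pos (fv (j+1))} 2 := by
    refine der_ax ht {Lit.pos (xvv (j+1)), Lit.pos (fv (j+1))} _ _ ?_ ?_ ?_ ?_ ?_
      Finset.card_le_two
    · simp only [psiMatrix, Finset.mem_union, List.mem_toFinset, List.mem_flatMap, List.mem_range]
      right
      exact ⟨j, by omega, by simp⟩
    · rintro ⟨x, h1, h2⟩
      simp at h2
    · simp [Clause.applySigv, applySigv, sig_f, sig_x t (j+1) (by omega) hj]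
    · rintro ⟨x, h1, h2⟩
      simp at h2
    · simp only [Finset.mem_insert, Finset.mem_singleton]
      rintro l (rfl | rfl)
      exacts [good_e (by omega) (by omega), good_f (by omega) (by omega)]
  refine der_res b a (ev (j+1)) (by simp) (by simp) _ 1 ?_ (by simp)
  ext l; cases l <;> simp [fv, ev] <;> omega

lemma fNegs_image (t : ℕ) :
    (fNegs t).toFinset.image (applySigv (sigmaEv t)) = (fNegs t).toFinset := by
  conv_rhs => rw [← Finset.image_id (s := (fNegs t).toFinset)]
  refine Finset.image_congr ?_
  intro l hl
  simp only [List.coe_toFinset, Set.mem_setOf_eq, mem_fNegs] at hl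
  obtain ⟨i, _, rfl⟩ := hl
  simp [applySigv, sig_f]

lemma der_fnegs {t : ℕ} (ht : 1 ≤ t) : Der t (fNegs t).toFinset (16 * t + 4) := by
  obtain ⟨s, rfl⟩ : ∃ s, t = s + 1 := ⟨t - 1, by omega⟩
  have hcard := fNegs_card (s+1)
  have hgood : ∀ l ∈ fNegs (s+1), GoodVar (s+1) l.var := by
    intro l hl
    obtain ⟨i, hi, rfl⟩ := (mem_fNegs _ _).1 hl
    exact good_f (by omega) (by omega)
  have hpos : ∀ x, Lit.pos x ∉ fNegs (s+1) := by simp [mem_fNegs]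
  have hneg : ∀ x, Lit.neg x ∈ fNegs (s+1) → x % 5 = 3 := by
    intro x hx
    obtain ⟨i, hi, h⟩ := (mem_fNegs _ _).1 hx
    simp [fv] at h; omega
  have a : Der (s+1) (insert (Lit.pos (dv (s+1))) (insert (Lit.neg (ev (s+1)))
      (fNegs (s+1)).toFinset)) (s + 3) := by
    refine der_ax ht ((Lit.pos (dv (s+1)) :: Lit.neg (xvv (s+1)) :: fNegs (s+1)).toFinset) _ _
      ?_ ?_ ?_ ?_ ?_ ?_
    · simp only [psiMatrix, Finset.mem_union, Finset.mem_insert]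
      simp
    · rintro ⟨x, h1, h2⟩
      simp [dv, xvv, hpos] at h1 h2
      rcases h2 with h2 | h2
      · omega
      · have := hneg _ h2; omega
    · simp [Clause.applySigv, Finset.image_insert, fNegs_image, applySigv, sig_d,
        sig_x (s+1) (s+1) ht le_rfl]
    · rintro ⟨x, h1, h2⟩
      simp [dv, ev, hpos] at h1 h2
      rcases h2 with h2 | h2
      · omega
      · have := hneg _ h2; omega
    · simp only [Finset.mem_insert, List.mem_toFinset]
      rintro l (rfl | rfl | h)
      exacts [good_d le_rfl, good_e ht le_rfl, hgood _ h]
    · have h1 := Finset.card_insert_le (Lit.pos (dv (s+1)))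
        (insert (Lit.neg (ev (s+1))) (fNegs (s+1)).toFinset)
      have h2 := Finset.card_insert_le (Lit.neg (ev (s+1))) (fNegs (s+1)).toFinset
      omega
  have b : Der (s+1) (insert (Lit.pos (ev (s+1))) (fNegs (s+1)).toFinset) (s + 2) := by
    refine der_ax ht ((Lit.pos (ev (s+1)) :: Lit.pos (xvv (s+1)) :: fNegs (s+1)).toFinset) _ _
      ?_ ?_ ?_ ?_ ?_ ?_
    · simp only [psiMatrix, Finset.mem_union, Finset.mem_insert]
      simp
    · rintro ⟨x, h1, h2⟩
      simp [ev, xvv, hpos] at h1 h2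
      have := hneg _ h2; omega
    · simp [Clause.applySigv, Finset.image_insert, fNegs_image, applySigv, sig_e,
        sig_x (s+1) (s+1) ht le_rfl]
    · rintro ⟨x, h1, h2⟩
      simp [ev, hpos] at h1 h2
      have := hneg _ h2; omega
    · simp only [Finset.mem_insert, List.mem_toFinset]
      rintro l (rfl | h)
      exacts [good_e ht le_rfl, hgood _ h]
    · have h2 := Finset.card_insert_le (Lit.pos (ev (s+1))) (fNegs (s+1)).toFinset
      omega
  have c : Der (s+1) (insert (Lit.neg (ev (s+1))) (fNegs (s+1)).toFinset)
      ((s + 3) + (6 + 12 * s) + (s + 2)) := by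
    refine der_res a (der_chain ht s le_rfl) (dv (s+1)) (by simp) (by simp) _ _ ?_ ?_
    · ext l
      cases l with
      | pos x => simp [hpos]
      | neg x =>
        simp [dv, ev]
    · have h2 := Finset.card_insert_le (Lit.neg (ev (s+1))) (fNegs (s+1)).toFinset
      omega
  have d : Der (s+1) (fNegs (s+1)).toFinset
      ((s + 2) + ((s + 3) + (6 + 12 * s) + (s + 2)) + (s + 1)) := by
    refine der_res b c (ev (s+1)) (by simp) (by simp) _ _ ?_ hcard
    ext l
    cases l with
    | pos x => simp [hpos]
    | neg x =>
      simp [ev]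
  obtain ⟨d, hd⟩ := d
  exact ⟨d, by omega⟩

lemma der_elim {t : ℕ} (k : ℕ) (hk : k ≤ t) (n : ℕ) (h : Der t (fNegs k).toFinset n) :
    Der t ∅ (n + k * (5 + t)) := by
  induction k generalizing n with
  | zero => simpa [fNegs] using h
  | succ k ih =>
    have hk' := fNegs_card k
    have r : Der t (fNegs k).toFinset (5 + n + t) := by
      refine der_res (der_unit hk) h (fv (k+1)) (by simp)
        (by rw [List.mem_toFinset, mem_fNegs]; exact ⟨k, by omega, rfl⟩) _ _ ?_ (by omega)
      ext l
      cases l with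
      | pos x => simp [mem_fNegs]; 
      | neg x =>
        simp only [Finset.mem_union, Finset.mem_erase, List.mem_toFinset, mem_fNegs]
        simp only [fv, Finset.mem_singleton, Lit.neg.injEq, reduceCtorEq, and_false, false_or,
          ne_eq]
        constructor
        · rintro ⟨h1, i, hi, rfl⟩
          exact ⟨i, by omega, rfl⟩
        · rintro ⟨i, hi, rfl⟩
          exact ⟨by omega, i, by omega, rfl⟩
    have := ih (by omega) _ r
    convert this using 1
    ring

/-- with σ_{v,t} = { x_i ↦ e_i }, the formula Ψ_t has a tree
refutation in IR-calc^{σ_{v,t}} of size polynomial in t. -/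
theorem short_tree_refutation_Psi_ircalc_subst :
    ∃ c : ℕ, ∀ t : ℕ, 1 ≤ t →
      ∃ d : IRTree (PsiF t) ∅ (sigmaEv t) ∅, d.size ≤ c * t ^ c := by
  refine ⟨26, fun t ht => ?_⟩
  obtain ⟨d, hd⟩ := der_elim t le_rfl _ (der_fnegs ht)
  refine ⟨d, hd.trans ?_⟩
  have h1 : t ^ 2 ≤ t ^ 26 := Nat.pow_le_pow_right ht (by norm_num)
  nlinarith
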